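/- arXiv:2006.06222 — 6 statements merged into one kernel-verified Lean document; each statement's English description precedes it below -/
import Mathlib

section
/- Let ζ > 0, ρ > 0, ε ∈ ℝ and let u ∈ ℝ be a constant. Suppose α : ℝ → ℝ is twice differentiable on an open interval I and satisfies on I the equation (ζ·sin²(ε−α) + 2)·α'' = (2+ζ)·sin α + sin ε · cos(ε−α) + (1/2)·ζ·(α')²·sin(2(ε−α)) − 2·((1/ρ)·cos(ε−α) + (1+2/ζ)·ρ)·u. Then the function E(t) = (ζ+2)·cos α(t) + sin ε · sin(ε−α(t)) + ((1/2)·ζ·sin²(ε−α(t)) + 1)·(α'(t))² + (2·(1+2/ζ)·ρ·α(t) − (2/ρ)·sin(ε−α(t)))·u has derivative zero at every point of I; i.e. E is a first integral of the motion. -/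
open Real

/-- First integral for the wheeled inverted pendulum on a hard surface with
constant inclination `ε` under constant control torque `u`. -/
theorem wip_first_integral_inclined
    (ζ ρ ε u : ℝ) (hζ : 0 < ζ) (hρ : 0 < ρ)
    (I : Set ℝ) (hI : IsOpen I)
    (α α' α'' : ℝ → ℝ)
    (hα : ∀ t ∈ I, HasDerivAt α (α' t) t)
    (hα' : ∀ t ∈ I, HasDerivAt α' (α'' t) t)
    (hode : ∀ t ∈ I,
      (ζ * sin (ε - α t) ^ 2 + 2) * α'' t =
        (2 + ζ) * sin (α t) + sin ε * cos (ε - α t)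
          + (1 / 2) * ζ * (α' t) ^ 2 * sin (2 * (ε - α t))
          - 2 * ((1 / ρ) * cos (ε - α t) + (1 + 2 / ζ) * ρ) * u) :
    ∀ t ∈ I,
      HasDerivAt (fun t =>
        (ζ + 2) * cos (α t) + sin ε * sin (ε - α t)
          + ((1 / 2) * ζ * sin (ε - α t) ^ 2 + 1) * (α' t) ^ 2
          + (2 * (1 + 2 / ζ) * ρ * α t - (2 / ρ) * sin (ε - α t)) * u) 0 t := by
  intro t ht
  have ha := hα t ht
  have hs := (ha.const_sub ε).sin
  have hE := (((ha.cos.const_mul (ζ + 2)).add (hs.const_mul (sin ε))).add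
    ((((hs.pow 2).const_mul ((1 / 2) * ζ)).add_const 1).mul ((hα' t ht).pow 2))).add
    (((ha.const_mul (2 * (1 + 2 / ζ) * ρ)).sub (hs.const_mul (2 / ρ))).mul_const u)
  refine hE.congr_deriv ?_
  have h := hode t ht
  rw [sin_two_mul] at h
  simp only [Pi.pow_apply]
  push_cast
  linear_combination α' t * h
end

section
/- Let ζ > 0, ρ > 0 and let u ∈ ℝ be a constant. Suppose α : ℝ → ℝ is twice differentiable on an open interval I and satisfies on I the equation (ζ·sin²α + 2)·α'' = (2+ζ)·sin α − (1/2)·ζ·(α')²·sin(2α) − 2·((1/ρ)·cos α + (1+2/ζ)·ρ)·u. Then the function E₀(t) = (ζ+2)·cos α(t) + ((1/2)·ζ·sin²α(t) + 1)·(α'(t))² + (2·(1+2/ζ)·ρ·α(t) + (2/ρ)·sin α(t))·u has derivative zero at every point of I; i.e. E₀ is constant along the solution. -/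
open Real

/-- First integral for the wheeled inverted pendulum on a hard horizontal surface
under constant control torque `u`. -/
theorem wip_first_integral_horizontal
    (ζ ρ u : ℝ) (hζ : 0 < ζ) (hρ : 0 < ρ)
    (I : Set ℝ) (hI : IsOpen I)
    (α α' α'' : ℝ → ℝ)
    (hα : ∀ t ∈ I, HasDerivAt α (α' t) t)
    (hα' : ∀ t ∈ I, HasDerivAt α' (α'' t) t)
    (hode : ∀ t ∈ I,
      (ζ * sin (α t) ^ 2 + 2) * α'' t =
        (2 + ζ) * sin (α t)
          - (1 / 2) * ζ * (α' t) ^ 2 * sin (2 * α t)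
          - 2 * ((1 / ρ) * cos (α t) + (1 + 2 / ζ) * ρ) * u) :
    ∀ t ∈ I,
      HasDerivAt (fun t =>
        (ζ + 2) * cos (α t)
          + ((1 / 2) * ζ * sin (α t) ^ 2 + 1) * (α' t) ^ 2
          + (2 * (1 + 2 / ζ) * ρ * α t + (2 / ρ) * sin (α t)) * u) 0 t := by
  intro t ht
  have ha := hα t ht
  have hode_t := hode t ht
  rw [sin_two_mul] at hode_t
  refine (((ha.cos.const_mul (ζ + 2)).add
    ((((ha.sin.pow 2).const_mul ((1 / 2) * ζ)).add_const 1).mul ((hα' t ht).pow 2))).add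
    (((ha.const_mul (2 * (1 + 2 / ζ) * ρ)).add
      (ha.sin.const_mul (2 / ρ))).mul_const u)).congr_deriv ?_
  simp only [Pi.pow_apply]
  push_cast
  linear_combination α' t * hode_t
end

section
/- Let ζ, ρ, ν, k₃ > 0, s ∈ {−1, 1}, and define A_s = s·ζ·ν·ρ / ((2·k₃·ζ + 4·k₃)·ρ² + 2·k₃·ζ). Set u = k₃·A_s and, for real constants t₀, β₀, β₁ with s·β₁ > 0, define β(t) = β₀ + β₁·(t−t₀) − (k₃·A_s/ζ)·(t−t₀)². Then on any interval on which s·β'(t) > 0, the pair α ≡ 0, β is a solution of the system for the pendulum on a soft horizontal surface: 0 = sin 0 − (cos 0 · β'' + sin 0 · (β')²)·ρ − 2·(ρ/ζ)·u and (ζ+2)·ρ·β'' = (2/ρ)·u − ν·s, where the right-hand side of the second equation is the rolling-friction branch f − ν·sgn(β') with f = (2/ρ)·u. -/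
open Real

/-- The explicit pair `α ≡ 0`, `β(t) = β₀ + β₁(t−t₀) − (k₃A_s/ζ)(t−t₀)²` is a
particular solution of the system for the wheeled inverted pendulum on a soft
horizontal surface, on any interval where `s·β'(t) > 0`. -/
theorem wip_particular_solution
    (ζ ρ ν k₃ : ℝ) (hζ : 0 < ζ) (hρ : 0 < ρ) (hν : 0 < ν) (hk₃ : 0 < k₃)
    (s : ℝ) (hs : s = -1 ∨ s = 1)
    (t₀ β₀ β₁ : ℝ) (hβ₁ : s * β₁ > 0)
    (A_s : ℝ)
    (hA : A_s = s * ζ * ν * ρ / ((2 * k₃ * ζ + 4 * k₃) * ρ ^ 2 + 2 * k₃ * ζ))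
    (u : ℝ) (hu : u = k₃ * A_s)
    (β βd βdd : ℝ → ℝ)
    (hβ : β = fun t => β₀ + β₁ * (t - t₀) - (k₃ * A_s / ζ) * (t - t₀) ^ 2)
    (hβd : βd = fun t => β₁ - (2 * k₃ * A_s / ζ) * (t - t₀))
    (hβdd : βdd = fun _ => -(2 * k₃ * A_s / ζ)) :
    ∀ t : ℝ, s * βd t > 0 →
      HasDerivAt β (βd t) t ∧ HasDerivAt βd (βdd t) t ∧
      (0 : ℝ) = sin 0 - (cos 0 * βdd t + sin 0 * (βd t) ^ 2) * ρ - 2 * (ρ / ζ) * u ∧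
      (ζ + 2) * ρ * βdd t = (2 / ρ) * u - ν * s := by
  intro t _
  have hd : HasDerivAt (fun x : ℝ => x - t₀) 1 t := (hasDerivAt_id t).sub_const t₀
  have hbalance : A_s * ((2 * k₃ * ζ + 4 * k₃) * ρ ^ 2 + 2 * k₃ * ζ) = s * ζ * ν * ρ := by
    rw [hA]
    exact div_mul_cancel₀ _ (by positivity)
  subst hβ hβd hβdd hu
  refine ⟨?_, ?_, ?_, ?_⟩
  · refine (((hd.const_mul β₁).const_add β₀).sub
      ((hd.pow 2).const_mul (k₃ * A_s / ζ))).congr_deriv ?_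
    push_cast
    ring
  · exact ((hd.const_mul (2 * k₃ * A_s / ζ)).const_sub β₁).congr_deriv (by ring)
  · simp only [sin_zero, cos_zero]
    ring
  · field_simp
    linear_combination -hbalance
end

section
/- Let γ, ζ, ρ, a₂, b₂, δ₂, δ₅ ∈ ℝ with ζ ≠ 0, ρ ≠ 0 and D = ((ρ² + 1)·γ − 1)·ζ + 2·ρ²·γ ≠ 0. Let (α, u) be the solution of the linear system a₂ = −(2·ρ/ζ)·u + (1 − γ)·α − ρ·b₂, (ζ + 2)·(ρ·b₂ + γ·α) = (2/ρ)·u − ζ·a₂, and let (ᾰ, ŭ) be the solution of the same system with data (a₂ + δ₂, b₂ + δ₅) in place of (a₂, b₂). Then ᾰ = α − ((ρ² + 1)·ζ/D)·δ₂ − (((ζ + 2)·ρ² + ζ)·ρ/D)·δ₅ and ŭ = u − ((ζ² + 2·γ·ζ)·ρ/(2·D))·δ₂ − ((ζ² + 2·ζ)·ρ²/(2·D))·δ₅; i.e. the errors of the observed angle and observed torque are linear in the measurement errors δ₂ of the tilt sensor and δ₅ of the horizontal acceleration with the displayed coefficients. -/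
/-- Errors of the observed angle `α_obs` and observed torque `u_obs` are linear
in the measurement errors `δ₂`, `δ₅` of the sensors, with the displayed
coefficients. -/
theorem wip_observation_errors
    (γ ζ ρ a₂ b₂ δ₂ δ₅ : ℝ) (hζ : ζ ≠ 0) (hρ : ρ ≠ 0)
    (D : ℝ) (hD : D = ((ρ ^ 2 + 1) * γ - 1) * ζ + 2 * ρ ^ 2 * γ)
    (hDne : D ≠ 0)
    (α u α_obs u_obs : ℝ)
    (heq1 : a₂ = -(2 * ρ / ζ) * u + (1 - γ) * α - ρ * b₂)
    (heq2 : (ζ + 2) * (ρ * b₂ + γ * α) = (2 / ρ) * u - ζ * a₂)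
    (heq1' : a₂ + δ₂ = -(2 * ρ / ζ) * u_obs + (1 - γ) * α_obs - ρ * (b₂ + δ₅))
    (heq2' : (ζ + 2) * (ρ * (b₂ + δ₅) + γ * α_obs) =
      (2 / ρ) * u_obs - ζ * (a₂ + δ₂)) :
    α_obs = α - ((ρ ^ 2 + 1) * ζ / D) * δ₂
          - (((ζ + 2) * ρ ^ 2 + ζ) * ρ / D) * δ₅ ∧
    u_obs = u - ((ζ ^ 2 + 2 * γ * ζ) * ρ / (2 * D)) * δ₂
          - ((ζ ^ 2 + 2 * ζ) * ρ ^ 2 / (2 * D)) * δ₅ := by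
  have tilt : ζ * δ₂ = -(2 * ρ) * (u_obs - u) + ζ * (1 - γ) * (α_obs - α) - ζ * ρ * δ₅ := by
    have h : δ₂ = -(2 * ρ / ζ) * (u_obs - u) + (1 - γ) * (α_obs - α) - ρ * δ₅ := by
      linear_combination heq1' - heq1
    rw [h]
    field_simp
  have torque : (ζ + 2) * ρ * (ρ * δ₅ + γ * (α_obs - α)) = 2 * (u_obs - u) - ζ * ρ * δ₂ := by
    have h : (ζ + 2) * (ρ * δ₅ + γ * (α_obs - α)) = (2 / ρ) * (u_obs - u) - ζ * δ₂ := by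
      linear_combination heq2' - heq2
    have hρ' : 2 / ρ * ρ = 2 := div_mul_cancel₀ 2 hρ
    linear_combination ρ * h + (u_obs - u) * hρ'
  have angle : D * (α_obs - α) =
      -((ρ ^ 2 + 1) * ζ * δ₂) - ((ζ + 2) * ρ ^ 2 + ζ) * ρ * δ₅ := by
    linear_combination (α_obs - α) * hD + tilt + ρ * torque
  have control : 2 * D * (u_obs - u) =
      -((ζ ^ 2 + 2 * γ * ζ) * ρ * δ₂) - (ζ ^ 2 + 2 * ζ) * ρ ^ 2 * δ₅ := by
    linear_combination (ζ + 2) * ρ * γ * angle - D * torque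
      + (ζ * ρ * δ₂ + (ζ + 2) * ρ ^ 2 * δ₅) * hD
  constructor
  · field_simp
    linear_combination angle
  · field_simp
    linear_combination control
end

section
/- Let γ, ζ, ρ, ν, a₁, a₂, b₁, b₂, α, u ∈ ℝ with cos α ≠ 0, ρ ≠ 0, ζ ≠ 0, b₁ ≠ 0, s = sgn(b₁). Suppose that a₂/cos α = −(cos α·(sin α·(γ − a₂)/(cos α·ρ) + b₂) + b₁²·sin α)·ρ − (2·ρ/ζ)·u + sin α and (ζ + 2)·(sin α·(γ − a₂)/(cos α·ρ) + b₂)·ρ = (2/ρ)·u − (a₂ − a₁²·sin α)·ζ − ν·s. Then α satisfies the trigonometric equation ρ²·sin α·(2·γ·ζ − 2·a₂·ζ + 4·γ − 4·a₂) + ζ·sin(2α)·(−a₁²·ρ² + b₁²·ρ + γ − a₂ − 1) = ρ²·cos α·(−2·b₂·ζ·ρ − 4·b₂·ρ − 2·a₂·ζ − 2·ν·s) − b₂·cos(2α)·ζ·ρ − b₂·ζ·ρ − 2·a₂·ζ. -/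
open Real

/-- Eliminating the control torque `u` from the observability equations for the
wheeled inverted pendulum on a soft horizontal surface (nonzero wheel rotation)
yields a single trigonometric equation for the pendulum angle `α`. -/
theorem wip_observability_soft
    (γ ζ ρ ν a₁ a₂ b₁ b₂ α u s : ℝ)
    (hcos : cos α ≠ 0) (hρ : ρ ≠ 0) (hζ : ζ ≠ 0) (hb₁ : b₁ ≠ 0)
    (hs : s = Real.sign b₁)
    (heq1 : a₂ / cos α =
      -(cos α * (sin α * (γ - a₂) / (cos α * ρ) + b₂) + b₁ ^ 2 * sin α) * ρ
        - (2 * ρ / ζ) * u + sin α)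
    (heq2 : (ζ + 2) * (sin α * (γ - a₂) / (cos α * ρ) + b₂) * ρ =
      (2 / ρ) * u - (a₂ - a₁ ^ 2 * sin α) * ζ - ν * s) :
    ρ ^ 2 * sin α * (2 * γ * ζ - 2 * a₂ * ζ + 4 * γ - 4 * a₂)
      + ζ * sin (2 * α) * (-a₁ ^ 2 * ρ ^ 2 + b₁ ^ 2 * ρ + γ - a₂ - 1)
    = ρ ^ 2 * cos α * (-2 * b₂ * ζ * ρ - 4 * b₂ * ρ - 2 * a₂ * ζ - 2 * ν * s)
      - b₂ * cos (2 * α) * ζ * ρ - b₂ * ζ * ρ - 2 * a₂ * ζ := by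
  have h1 : a₂ * ζ = -(cos α * ζ * (sin α * (γ - a₂) + cos α * b₂ * ρ + b₁ ^ 2 * sin α * ρ))
      - 2 * ρ * cos α * u + cos α * sin α * ζ := by
    field_simp at heq1
    linear_combination heq1
  have h2 : ρ ^ 2 * ((ζ + 2) * (sin α * (γ - a₂) + b₂ * ρ * cos α)) =
      2 * ρ * u * cos α - cos α * ρ ^ 2 * ((a₂ - a₁ ^ 2 * sin α) * ζ + ν * s) := by
    field_simp at heq2
    linear_combination ρ * heq2
  rw [sin_two_mul, cos_two_mul]
  linear_combination 2 * h1 + 2 * h2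
end

section
/- Let γ, ζ, ρ, a₁, a₂, b₁, b₂, α, u ∈ ℝ with cos α ≠ 0, ρ ≠ 0, ζ ≠ 0. Suppose that a₂/cos α = −(cos α·(sin α·(γ − a₂)/(cos α·ρ) + b₂) + b₁²·sin α)·ρ − (2·ρ/ζ)·u + sin α and (ζ + 2)·(sin α·(γ − a₂)/(cos α·ρ) + b₂)·ρ = (2/ρ)·u − (a₂ − a₁²·sin α)·ζ. Then α satisfies the trigonometric equation ρ²·sin α·(2·γ·ζ − 2·a₂·ζ + 4·γ − 4·a₂) + ζ·sin(2α)·(−a₁²·ρ² + b₁²·ρ + γ − a₂ − 1) = ρ²·cos α·(−2·b₂·ζ·ρ − 4·b₂·ρ − 2·a₂·ζ) − b₂·cos(2α)·ζ·ρ − b₂·ζ·ρ − 2·a₂·ζ. -/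
open Real

/-- Eliminating the control torque `u` from the observability equations for the
wheeled inverted pendulum on a hard horizontal surface yields a single
trigonometric equation for the pendulum angle `α`. -/
theorem wip_observability_hard
    (γ ζ ρ a₁ a₂ b₁ b₂ α u : ℝ)
    (hcos : cos α ≠ 0) (hρ : ρ ≠ 0) (hζ : ζ ≠ 0)
    (heq1 : a₂ / cos α =
      -(cos α * (sin α * (γ - a₂) / (cos α * ρ) + b₂) + b₁ ^ 2 * sin α) * ρ
        - (2 * ρ / ζ) * u + sin α)
    (heq2 : (ζ + 2) * (sin α * (γ - a₂) / (cos α * ρ) + b₂) * ρ =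
      (2 / ρ) * u - (a₂ - a₁ ^ 2 * sin α) * ζ) :
    ρ ^ 2 * sin α * (2 * γ * ζ - 2 * a₂ * ζ + 4 * γ - 4 * a₂)
      + ζ * sin (2 * α) * (-a₁ ^ 2 * ρ ^ 2 + b₁ ^ 2 * ρ + γ - a₂ - 1)
    = ρ ^ 2 * cos α * (-2 * b₂ * ζ * ρ - 4 * b₂ * ρ - 2 * a₂ * ζ)
      - b₂ * cos (2 * α) * ζ * ρ - b₂ * ζ * ρ - 2 * a₂ * ζ := by
  have hforce : ζ * a₂ = -(ζ * cos α * sin α * (γ - a₂)) - ζ * cos α ^ 2 * b₂ * ρ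
      - ζ * cos α * b₁ ^ 2 * sin α * ρ - 2 * ρ * cos α * u + ζ * sin α * cos α := by
    calc ζ * a₂ = ζ * cos α * (a₂ / cos α) := by field_simp
      _ = _ := by rw [heq1]; field_simp; ring
  have hwheel : ρ ^ 2 * (ζ + 2) * (sin α * (γ - a₂) + b₂ * cos α * ρ) =
      2 * cos α * ρ * u - cos α * ρ ^ 2 * ζ * (a₂ - a₁ ^ 2 * sin α) := by
    calc ρ ^ 2 * (ζ + 2) * (sin α * (γ - a₂) + b₂ * cos α * ρ)
        = cos α * ρ ^ 2 * ((ζ + 2) * (sin α * (γ - a₂) / (cos α * ρ) + b₂) * ρ) := by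
          field_simp
      _ = _ := by rw [heq2]; field_simp
  rw [sin_two_mul, cos_two_mul]
  linear_combination 2 * hwheel + 2 * hforce
end
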